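/- Let X ⊆ ℂⁿ be open and let Ω ⊆ X be open with closure cl Ω (taken in X) properly contained in X; set Ω^c = X \ cl Ω. Assume: (i) every d-closed smooth (1,1)-form on X equals dh for some smooth 1-form h on X; (ii) every ∂̄-closed smooth (0,1)-form on X equals ∂̄g for some smooth function g on X; (iii) every ∂-closed smooth (1,0)-form on X equals ∂g for some smooth function g on X; (iv) every smooth function on X that is pluriharmonic on Ω^c coincides on Ω^c with a pluriharmonic function defined on all of X. Then for every d-closed smooth (1,1)-form f on X with support contained in cl Ω, there exists a smooth function v̌ on X with support contained in cl Ω such that ∂∂̄v̌ = f, i.e. ∂²v̌/∂z_j∂z̄_k = f_{jk} for all j,k. -/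

import Mathlib

open Complex

noncomputable section

/-- Wirtinger derivative `∂u/∂z_j` of `u` within the set `X`, at `z`. -/
def wdz {n : ℕ} (X : Set (Fin n → ℂ)) (u : (Fin n → ℂ) → ℂ) (j : Fin n)
    (z : Fin n → ℂ) : ℂ :=
  (1 / 2 : ℂ) * (fderivWithin ℝ u X z (Pi.single j 1) -
    Complex.I * fderivWithin ℝ u X z (Pi.single j Complex.I))

/-- Wirtinger derivative `∂u/∂z̄_j` of `u` within the set `X`, at `z`. -/
def wdzbar {n : ℕ} (X : Set (Fin n → ℂ)) (u : (Fin n → ℂ) → ℂ) (j : Fin n)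
    (z : Fin n → ℂ) : ℂ :=
  (1 / 2 : ℂ) * (fderivWithin ℝ u X z (Pi.single j 1) +
    Complex.I * fderivWithin ℝ u X z (Pi.single j Complex.I))

/-- `∂²u/∂z_j∂z̄_k` within `X`. -/
def ddbar {n : ℕ} (X : Set (Fin n → ℂ)) (u : (Fin n → ℂ) → ℂ) (j k : Fin n)
    (z : Fin n → ℂ) : ℂ :=
  wdz X (wdzbar X u k) j z

/-- The support of `u` as a function on `X`: the closure in `X` of its nonvanishing set. -/
def suppIn {n : ℕ} (X : Set (Fin n → ℂ)) (u : (Fin n → ℂ) → ℂ) : Set (Fin n → ℂ) :=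
  X ∩ closure {z | z ∈ X ∧ u z ≠ 0}

/-- Support of a (1,1)-form given by its coefficient matrix. -/
def supp11 {n : ℕ} (X : Set (Fin n → ℂ)) (T : Fin n → Fin n → (Fin n → ℂ) → ℂ) :
    Set (Fin n → ℂ) :=
  ⋃ j, ⋃ k, suppIn X (T j k)

/-- Support of a 1-form `Σ a_j dz_j + Σ b_k dz̄_k`. -/
def supp1 {n : ℕ} (X : Set (Fin n → ℂ)) (a b : Fin n → (Fin n → ℂ) → ℂ) :
    Set (Fin n → ℂ) :=
  (⋃ j, suppIn X (a j)) ∪ (⋃ k, suppIn X (b k))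

/-- Smoothness of the coefficients of a (1,1)-form on `X`. -/
def Smooth11 {n : ℕ} (X : Set (Fin n → ℂ)) (f : Fin n → Fin n → (Fin n → ℂ) → ℂ) : Prop :=
  ∀ j k, ContDiffOn ℝ (⊤ : ℕ∞) (f j k) X

/-- A (1,1)-form `Σ f_{jk} dz_j ∧ dz̄_k` is d-closed. -/
def DClosed11 {n : ℕ} (X : Set (Fin n → ℂ)) (f : Fin n → Fin n → (Fin n → ℂ) → ℂ) : Prop :=
  ∀ j k l, ∀ z ∈ X,
    wdz X (f j k) l z = wdz X (f l k) j z ∧ wdzbar X (f j k) l z = wdzbar X (f j l) k z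

/-- `d(Σ a_j dz_j + Σ b_k dz̄_k) = f` for a (1,1)-form `f`. -/
def IsDOf {n : ℕ} (X : Set (Fin n → ℂ)) (a b : Fin n → (Fin n → ℂ) → ℂ)
    (f : Fin n → Fin n → (Fin n → ℂ) → ℂ) : Prop :=
  (∀ j k, ∀ z ∈ X, f j k z = wdz X (b k) j z - wdzbar X (a j) k z) ∧
  (∀ j l, ∀ z ∈ X, wdz X (a j) l z = wdz X (a l) j z) ∧
  (∀ k l, ∀ z ∈ X, wdzbar X (b k) l z = wdzbar X (b l) k z)

/-- A (0,1)-form `Σ b_k dz̄_k` is ∂̄-closed. -/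
def DbarClosed01 {n : ℕ} (X : Set (Fin n → ℂ)) (b : Fin n → (Fin n → ℂ) → ℂ) : Prop :=
  ∀ k l, ∀ z ∈ X, wdzbar X (b k) l z = wdzbar X (b l) k z

/-- A (1,0)-form `Σ a_j dz_j` is ∂-closed. -/
def DClosed10 {n : ℕ} (X : Set (Fin n → ℂ)) (a : Fin n → (Fin n → ℂ) → ℂ) : Prop :=
  ∀ j l, ∀ z ∈ X, wdz X (a j) l z = wdz X (a l) j z

section Wirtinger

variable {n : ℕ} {X : Set (Fin n → ℂ)} {u v : (Fin n → ℂ) → ℂ} {z : Fin n → ℂ}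

theorem wdz_congr (h : Set.EqOn u v X) (j : Fin n) (hz : z ∈ X) :
    wdz X u j z = wdz X v j z := by
  simp only [wdz, fderivWithin_congr h (h hz)]

theorem wdzbar_congr (h : Set.EqOn u v X) (j : Fin n) (hz : z ∈ X) :
    wdzbar X u j z = wdzbar X v j z := by
  simp only [wdzbar, fderivWithin_congr h (h hz)]

theorem wdz_sub (hX : IsOpen X) (hu : DifferentiableOn ℝ u X) (hv : DifferentiableOn ℝ v X)
    (j : Fin n) (hz : z ∈ X) :
    wdz X (fun w => u w - v w) j z = wdz X u j z - wdz X v j z := by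
  simp only [wdz, fderivWithin_fun_sub (hX.uniqueDiffWithinAt hz) (hu z hz) (hv z hz),
    sub_apply]
  ring

theorem wdzbar_sub (hX : IsOpen X) (hu : DifferentiableOn ℝ u X) (hv : DifferentiableOn ℝ v X)
    (j : Fin n) (hz : z ∈ X) :
    wdzbar X (fun w => u w - v w) j z = wdzbar X u j z - wdzbar X v j z := by
  simp only [wdzbar, fderivWithin_fun_sub (hX.uniqueDiffWithinAt hz) (hu z hz) (hv z hz),
    sub_apply]
  ring

theorem ContDiffOn.differentiableOn_fderivWithin_of_isOpen (hX : IsOpen X)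
    (hu : ContDiffOn ℝ (⊤ : ℕ∞) u X) : DifferentiableOn ℝ (fderivWithin ℝ u X) X :=
  (hu.fderivWithin hX.uniqueDiffOn (m := (⊤ : ℕ∞)) (by simp)).differentiableOn (by simp)

theorem ContDiffOn.differentiableOn_wdzbar (hX : IsOpen X)
    (hu : ContDiffOn ℝ (⊤ : ℕ∞) u X) (k : Fin n) : DifferentiableOn ℝ (wdzbar X u k) X := by
  have h := hu.differentiableOn_fderivWithin_of_isOpen hX
  unfold wdzbar
  fun_prop

theorem fderivWithin_fderivWithin_apply (hX : IsOpen X) (hu : ContDiffOn ℝ (⊤ : ℕ∞) u X)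
    (hz : z ∈ X) (c : ℂ) (e e' d : Fin n → ℂ) :
    fderivWithin ℝ (fun w => (1 / 2 : ℂ) * (fderivWithin ℝ u X w e + c * fderivWithin ℝ u X w e'))
        X z d =
      (1 / 2 : ℂ) * (fderivWithin ℝ (fderivWithin ℝ u X) X z d e +
        c * fderivWithin ℝ (fderivWithin ℝ u X) X z d e') := by
  have h := (hu.differentiableOn_fderivWithin_of_isOpen hX z hz).hasFDerivWithinAt
  have h1 := ((h.clm_apply (hasFDerivWithinAt_const e z X)).add
    ((h.clm_apply (hasFDerivWithinAt_const e' z X)).const_mul c)).const_mul (1 / 2 : ℂ)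
  have h2 := h1.fderivWithin (hX.uniqueDiffWithinAt hz)
  refine (congrArg (fun L => L d) h2).trans ?_
  simp [mul_add]

theorem wdzbar_wdz_eq_ddbar (hX : IsOpen X) (hu : ContDiffOn ℝ (⊤ : ℕ∞) u X)
    (j k : Fin n) (hz : z ∈ X) : wdzbar X (wdz X u j) k z = ddbar X u j k z := by
  have hs : IsSymmSndFDerivWithinAt ℝ u X z :=
    (hu z hz).isSymmSndFDerivWithinAt
      (by simpa using WithTop.coe_le_coe.2 (le_top : (2 : ℕ∞) ≤ ⊤)) hX.uniqueDiffOn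
      (subset_closure (by rwa [hX.interior_eq])) hz
  have hw : wdz X u j = fun w => (1 / 2 : ℂ) * (fderivWithin ℝ u X w (Pi.single j 1) +
      (-Complex.I) * fderivWithin ℝ u X w (Pi.single j Complex.I)) := by
    funext w
    simp only [wdz]
    ring
  have hwb : wdzbar X u k = fun w => (1 / 2 : ℂ) * (fderivWithin ℝ u X w (Pi.single k 1) +
      Complex.I * fderivWithin ℝ u X w (Pi.single k Complex.I)) := rfl
  rw [ddbar, hw, hwb, wdz, wdzbar]
  simp only [fderivWithin_fderivWithin_apply hX hu hz]
  rw [hs.eq (Pi.single k 1) (Pi.single j 1), hs.eq (Pi.single k 1) (Pi.single j Complex.I),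
    hs.eq (Pi.single k Complex.I) (Pi.single j 1),
    hs.eq (Pi.single k Complex.I) (Pi.single j Complex.I)]
  ring

theorem ddbar_sub (hX : IsOpen X) (hu : ContDiffOn ℝ (⊤ : ℕ∞) u X)
    (hv : ContDiffOn ℝ (⊤ : ℕ∞) v X) (j k : Fin n) (hz : z ∈ X) :
    ddbar X (fun w => u w - v w) j k z = ddbar X u j k z - ddbar X v j k z := by
  have hk : Set.EqOn (wdzbar X (fun w => u w - v w) k)
      (fun w => wdzbar X u k w - wdzbar X v k w) X := fun w hw =>
    wdzbar_sub hX (hu.differentiableOn (by simp)) (hv.differentiableOn (by simp)) k hw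
  rw [ddbar, wdz_congr hk j hz,
    wdz_sub hX (hu.differentiableOn_wdzbar hX k) (hv.differentiableOn_wdzbar hX k) j hz]
  rfl

end Wirtinger

/-- If the cohomological hypotheses (i), (ii), (iii) hold on `X` and every
smooth function on `X` pluriharmonic on `Ωᶜ = X \ cl Ω` coincides on `Ωᶜ` with a
pluriharmonic function on `X`, then every d-closed smooth (1,1)-form `f` supported in
`cl Ω` can be written `f = ∂∂̄v̌` with `v̌` smooth and supported in `cl Ω`. -/
theorem stmt8 {n : ℕ} (hn : 0 < n) (X : Set (Fin n → ℂ)) (hX : IsOpen X)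
    (Ω : Set (Fin n → ℂ)) (hΩ : IsOpen Ω) (hΩX : Ω ⊆ X)
    (hProper : (X \ closure Ω).Nonempty)
    (hi : ∀ f : Fin n → Fin n → (Fin n → ℂ) → ℂ, Smooth11 X f → DClosed11 X f →
      ∃ a b : Fin n → (Fin n → ℂ) → ℂ,
        (∀ j, ContDiffOn ℝ (⊤ : ℕ∞) (a j) X) ∧ (∀ k, ContDiffOn ℝ (⊤ : ℕ∞) (b k) X) ∧ IsDOf X a b f)
    (hii : ∀ b : Fin n → (Fin n → ℂ) → ℂ, (∀ k, ContDiffOn ℝ (⊤ : ℕ∞) (b k) X) →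
      DbarClosed01 X b →
      ∃ g : (Fin n → ℂ) → ℂ, ContDiffOn ℝ (⊤ : ℕ∞) g X ∧ ∀ k, ∀ z ∈ X, b k z = wdzbar X g k z)
    (hiii : ∀ a : Fin n → (Fin n → ℂ) → ℂ, (∀ j, ContDiffOn ℝ (⊤ : ℕ∞) (a j) X) →
      DClosed10 X a →
      ∃ g : (Fin n → ℂ) → ℂ, ContDiffOn ℝ (⊤ : ℕ∞) g X ∧ ∀ j, ∀ z ∈ X, a j z = wdz X g j z)
    (hiv : ∀ Sf : (Fin n → ℂ) → ℂ, ContDiffOn ℝ (⊤ : ℕ∞) Sf X →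
      (∀ j k, ∀ z ∈ X \ closure Ω, ddbar X Sf j k z = 0) →
      ∃ h : (Fin n → ℂ) → ℂ, ContDiffOn ℝ (⊤ : ℕ∞) h X ∧
        (∀ j k, ∀ z ∈ X, ddbar X h j k z = 0) ∧ Set.EqOn h Sf (X \ closure Ω)) :
    ∀ f : Fin n → Fin n → (Fin n → ℂ) → ℂ, Smooth11 X f → DClosed11 X f →
      supp11 X f ⊆ X ∩ closure Ω →
      ∃ v : (Fin n → ℂ) → ℂ, ContDiffOn ℝ (⊤ : ℕ∞) v X ∧ suppIn X v ⊆ X ∩ closure Ω ∧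
        ∀ j k, ∀ z ∈ X, f j k z = ddbar X v j k z := by
  intro f hf hfd hfs
  obtain ⟨a, b, ha, hb, hfab, haa, hbb⟩ := hi f hf hfd
  obtain ⟨g₁, hg₁, hbg⟩ := hii b hb hbb
  obtain ⟨g₂, hg₂, hag⟩ := hiii a ha haa
  have hu : ContDiffOn ℝ (⊤ : ℕ∞) (fun w => g₁ w - g₂ w) X := hg₁.sub hg₂
  have hfu : ∀ j k, ∀ z ∈ X, f j k z = ddbar X (fun w => g₁ w - g₂ w) j k z := by
    intro j k z hz
    rw [hfab j k z hz, ddbar_sub hX hg₁ hg₂ j k hz, wdz_congr (hbg k) j hz,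
      wdzbar_congr (hag j) k hz, wdzbar_wdz_eq_ddbar hX hg₂ j k hz]
    rfl
  obtain ⟨h, hh, hh0, hhu⟩ := hiv _ hu fun j k z hz => by
    rw [← hfu j k z hz.1]
    by_contra hne
    exact hz.2 (hfs (Set.mem_iUnion₂.2 ⟨j, k, hz.1, subset_closure ⟨hz.1, hne⟩⟩)).2
  refine ⟨fun w => (g₁ w - g₂ w) - h w, hu.sub hh, ?_, fun j k z hz => ?_⟩
  · refine Set.inter_subset_inter_right X (closure_minimal ?_ isClosed_closure)
    rintro z ⟨hzX, hz⟩
    by_contra hzΩ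
    exact hz (sub_eq_zero.2 (hhu ⟨hzX, hzΩ⟩).symm)
  · rw [ddbar_sub hX hu hh j k hz, hh0 j k z hz, sub_zero, hfu j k z hz]
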